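/- Let F be a field. Then P_8(F) ∩ P_{2,8}(F) = { diag(g₀, h₀, J_2 ᵗg₀^{−1} J_2) · v : g₀ ∈ GL_2(F), h₀ ∈ P_4(F), v ∈ N_{2,8}(F) }, where diag(g₀, h₀, J_2 ᵗg₀^{−1} J_2) is the 8×8 block diagonal matrix with blocks of sizes 2, 4, 2. -/

import Mathlib

open Matrix

namespace GS

noncomputable section

/-- `Jmat F n` : the `n × n` matrix over `F` with ones on the antidiagonal, zeros elsewhere. -/
def Jmat (F : Type*) [Field F] (n : ℕ) : Matrix (Fin n) (Fin n) F :=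
  Matrix.of fun i j => if (i : ℕ) + (j : ℕ) = n - 1 then (1 : F) else 0

/-- The symplectic form matrix `((0, J_n), (-J_n, 0))` in `n × n` block form. -/
def OmegaMat (F : Type*) [Field F] (n : ℕ) : Matrix (Fin (n + n)) (Fin (n + n)) F :=
  Matrix.reindex finSumFinEquiv finSumFinEquiv
    (Matrix.fromBlocks 0 (Jmat F n) (-(Jmat F n)) 0)

/-- `Sp_{2n}(F) = { g : ᵗg Ω g = Ω }`. -/
def SpSet (F : Type*) [Field F] (n : ℕ) : Set (Matrix (Fin (n + n)) (Fin (n + n)) F) :=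
  {g | gᵀ * OmegaMat F n * g = OmegaMat F n}

/-- `Sp_4(F)`. -/
def Sp4 (F : Type*) [Field F] : Set (Matrix (Fin 4) (Fin 4) F) := SpSet F 2

/-- `Sp_8(F)`. -/
def Sp8 (F : Type*) [Field F] : Set (Matrix (Fin 8) (Fin 8) F) := SpSet F 4

/-- `Sp_16(F)`. -/
def Sp16 (F : Type*) [Field F] : Set (Matrix (Fin 16) (Fin 16) F) := SpSet F 8

/-- `Mat_2^0(F) = { A : ᵗA J₂ = J₂ A }`. -/
def Mat20 (F : Type*) [Field F] : Set (Matrix (Fin 2) (Fin 2) F) :=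
  {A | Aᵀ * Jmat F 2 = Jmat F 2 * A}

/-- `y* = J₂ ᵗy J₂`. -/
def starJ (F : Type*) [Field F] (y : Matrix (Fin 2) (Fin 2) F) : Matrix (Fin 2) (Fin 2) F :=
  Jmat F 2 * yᵀ * Jmat F 2

/-- Assemble an `8 × 8` matrix from sixteen `2 × 2` blocks. -/
def blk8 (F : Type*) [Field F] (B : Fin 4 → Fin 4 → Matrix (Fin 2) (Fin 2) F) :
    Matrix (Fin 8) (Fin 8) F :=
  Matrix.of fun i j =>
    B ⟨(i : ℕ) / 2, by have := i.isLt; omega⟩ ⟨(j : ℕ) / 2, by have := j.isLt; omega⟩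
      ⟨(i : ℕ) % 2, by omega⟩ ⟨(j : ℕ) % 2, by omega⟩

/-- The matrix `v(x, y, z)`: identity except block `(1,2) = x`, `(1,3) = y`,
`(1,4) = z`, `(2,4) = y* = J₂ ᵗy J₂`, `(3,4) = x* = -J₂ ᵗx J₂`. -/
def vMat (F : Type*) [Field F] (x y z : Matrix (Fin 2) (Fin 2) F) :
    Matrix (Fin 8) (Fin 8) F :=
  blk8 F fun bi bj =>
    if bi = bj then (1 : Matrix (Fin 2) (Fin 2) F)
    else if bi = 0 ∧ bj = 1 then x
    else if bi = 0 ∧ bj = 2 then y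
    else if bi = 0 ∧ bj = 3 then z
    else if bi = 1 ∧ bj = 3 then starJ F y
    else if bi = 2 ∧ bj = 3 then -(starJ F x)
    else 0

/-- `N_{2,8}(F)`. -/
def N28 (F : Type*) [Field F] : Set (Matrix (Fin 8) (Fin 8) F) :=
  {M | ∃ x y z : Matrix (Fin 2) (Fin 2) F,
    z - x * starJ F y ∈ Mat20 F ∧ M = vMat F x y z}

/-- The center subgroup `N_{2,8}^c(F) = { v(0,0,z) : z ∈ Mat_2^0(F) }`. -/
def N28c (F : Type*) [Field F] : Set (Matrix (Fin 8) (Fin 8) F) :=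
  {M | ∃ z ∈ Mat20 F, M = vMat F 0 0 z}

/-- The underlying set of the Heisenberg group `H_9(F)`. -/
abbrev H9 (F : Type*) [Field F] :=
  Matrix (Fin 2) (Fin 2) F × Matrix (Fin 2) (Fin 2) F × F

/-- The Heisenberg multiplication on `H_9(F)` attached to `T`. -/
def H9mul (F : Type*) [Field F] (T : Matrix (Fin 2) (Fin 2) F) (a b : H9 F) : H9 F :=
  (a.1 + b.1, a.2.1 + b.2.1,
    a.2.2 + b.2.2 +
      (T * (a.1 * (Jmat F 2 * b.2.1ᵀ * Jmat F 2) -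
            a.2.1 * (Jmat F 2 * b.1ᵀ * Jmat F 2))).trace)

/-- The `8 × 8` block diagonal matrix `diag(m, h, m')` with blocks of sizes `2, 4, 2`. -/
def diag242 (F : Type*) [Field F] (m : Matrix (Fin 2) (Fin 2) F)
    (h : Matrix (Fin 4) (Fin 4) F) (m' : Matrix (Fin 2) (Fin 2) F) :
    Matrix (Fin 8) (Fin 8) F :=
  Matrix.of fun i j =>
    if hi : (i : ℕ) < 2 then
      if hj : (j : ℕ) < 2 then m ⟨(i : ℕ), hi⟩ ⟨(j : ℕ), hj⟩ else 0
    else if hi2 : (i : ℕ) < 6 then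
      if hj2 : 2 ≤ (j : ℕ) ∧ (j : ℕ) < 6 then
        h ⟨(i : ℕ) - 2, by omega⟩ ⟨(j : ℕ) - 2, by omega⟩
      else 0
    else
      if hj3 : 6 ≤ (j : ℕ) then
        m' ⟨(i : ℕ) - 6, by have := i.isLt; omega⟩ ⟨(j : ℕ) - 6, by have := j.isLt; omega⟩
      else 0

/-- The segment (`{1,2}`, `{3,4,5,6}` or `{7,8}`) of an index in `Fin 8`. -/
def seg8 (i : Fin 8) : ℕ := if (i : ℕ) < 2 then 0 else if (i : ℕ) < 6 then 1 else 2

/-- `w = ((0, I₂), (I₂, 0))`. -/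
def wMat (F : Type*) [Field F] : Matrix (Fin 4) (Fin 4) F :=
  Matrix.reindex finSumFinEquiv finSumFinEquiv
    (Matrix.fromBlocks (0 : Matrix (Fin 2) (Fin 2) F) (1 : Matrix (Fin 2) (Fin 2) F)
      (1 : Matrix (Fin 2) (Fin 2) F) (0 : Matrix (Fin 2) (Fin 2) F))

/-- The embedding `t : Sp₄ × Sp₄ → Mat₁₆`, with respect to the partition of `{1,…,16}`
into `I₁ = {1,…,4}`, `I₂ = {5,6}`, `I₃ = {7,…,10}`, `I₄ = {11,12}`, `I₅ = {13,…,16}`: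
block `(I₁,I₁) = g₁`, `(I₃,I₃) = g₂`, `(I₅,I₅) = J₄ ᵗg₁⁻¹ J₄`, `(I₂,I₂) = g_{1,1}`,
`(I₂,I₄) = g_{1,2}`, `(I₄,I₂) = g_{1,3}`, `(I₄,I₄) = g_{1,4}`, all other blocks zero. -/
def tEmb (F : Type*) [Field F] (g₁ g₂ : Matrix (Fin 4) (Fin 4) F) :
    Matrix (Fin 16) (Fin 16) F :=
  Matrix.of fun i j =>
    if hi1 : (i : ℕ) < 4 then
      if hj1 : (j : ℕ) < 4 then g₁ ⟨(i : ℕ), hi1⟩ ⟨(j : ℕ), hj1⟩ else 0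
    else if hi2 : (i : ℕ) < 6 then
      if hj2 : 4 ≤ (j : ℕ) ∧ (j : ℕ) < 6 then
        g₁ ⟨(i : ℕ) - 4, by omega⟩ ⟨(j : ℕ) - 4, by omega⟩
      else if hj4 : 10 ≤ (j : ℕ) ∧ (j : ℕ) < 12 then
        g₁ ⟨(i : ℕ) - 4, by omega⟩ ⟨(j : ℕ) - 10 + 2, by omega⟩
      else 0
    else if hi3 : (i : ℕ) < 10 then
      if hj3 : 6 ≤ (j : ℕ) ∧ (j : ℕ) < 10 then
        g₂ ⟨(i : ℕ) - 6, by omega⟩ ⟨(j : ℕ) - 6, by omega⟩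
      else 0
    else if hi4 : (i : ℕ) < 12 then
      if hj2 : 4 ≤ (j : ℕ) ∧ (j : ℕ) < 6 then
        g₁ ⟨(i : ℕ) - 10 + 2, by omega⟩ ⟨(j : ℕ) - 4, by omega⟩
      else if hj4 : 10 ≤ (j : ℕ) ∧ (j : ℕ) < 12 then
        g₁ ⟨(i : ℕ) - 10 + 2, by omega⟩ ⟨(j : ℕ) - 10 + 2, by omega⟩
      else 0
    else
      if hj5 : 12 ≤ (j : ℕ) then
        (Jmat F 4 * (g₁⁻¹)ᵀ * Jmat F 4) ⟨(i : ℕ) - 12, by have := i.isLt; omega⟩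
          ⟨(j : ℕ) - 12, by have := j.isLt; omega⟩
      else 0

/-- `γ₁`: entry `(1,8) = -1`, entries `(k,k) = 1` for `2 ≤ k ≤ 7`, entry `(8,1) = 1`
(1-indexed), all other entries `0`. -/
def gamma1 (F : Type*) [Field F] : Matrix (Fin 8) (Fin 8) F :=
  Matrix.of fun i j =>
    if (i : ℕ) = 0 ∧ (j : ℕ) = 7 then -1
    else if (i : ℕ) = 7 ∧ (j : ℕ) = 0 then 1
    else if i = j ∧ 1 ≤ (i : ℕ) ∧ (i : ℕ) ≤ 6 then 1
    else 0

/-- `γ₂`: block (rows 1–2, columns 7–8) `= -I₂`, block (rows 3–6, columns 3–6) `= I₄`,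
block (rows 7–8, columns 1–2) `= I₂` (1-indexed), all other entries `0`. -/
def gamma2 (F : Type*) [Field F] : Matrix (Fin 8) (Fin 8) F :=
  Matrix.of fun i j =>
    if (i : ℕ) < 2 ∧ (j : ℕ) = (i : ℕ) + 6 then -1
    else if 2 ≤ (i : ℕ) ∧ (i : ℕ) < 6 ∧ i = j then 1
    else if 6 ≤ (i : ℕ) ∧ (j : ℕ) + 6 = (i : ℕ) then 1
    else 0

/-- The Siegel parabolic `P_8(F)` of `Sp_8(F)`: lower-left `4 × 4` block zero. -/
def P8 (F : Type*) [Field F] : Set (Matrix (Fin 8) (Fin 8) F) :=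
  {g | g ∈ Sp8 F ∧ ∀ i j : Fin 8, 4 ≤ (i : ℕ) → (j : ℕ) < 4 → g i j = 0}

/-- The Siegel parabolic `P_4(F)` of `Sp_4(F)`: lower-left `2 × 2` block zero. -/
def P4 (F : Type*) [Field F] : Set (Matrix (Fin 4) (Fin 4) F) :=
  {h | h ∈ Sp4 F ∧ ∀ i j : Fin 4, 2 ≤ (i : ℕ) → (j : ℕ) < 2 → h i j = 0}

/-- The span of the first two standard basis vectors `e₁, e₂` of `F^8`. -/
def E2 (F : Type*) [Field F] : Submodule F (Fin 8 → F) :=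
  Submodule.span F {Pi.single (0 : Fin 8) (1 : F), Pi.single (1 : Fin 8) (1 : F)}

/-- `P_{2,8}(F)`: elements of `Sp_8(F)` mapping the span of `e₁, e₂` onto itself. -/
def P28 (F : Type*) [Field F] : Set (Matrix (Fin 8) (Fin 8) F) :=
  {g | g ∈ Sp8 F ∧ Submodule.map g.mulVecLin (E2 F) = E2 F}

/-- The double coset `P_8(F) · γ · P_{2,8}(F)`. -/
def dcoset (F : Type*) [Field F] (γ : Matrix (Fin 8) (Fin 8) F) :
    Set (Matrix (Fin 8) (Fin 8) F) :=
  {g | ∃ p ∈ P8 F, ∃ q ∈ P28 F, g = p * γ * q}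

/-- The orbit of `ξ` under the right multiplication action of `GL₂(F)` on `Mat₂(F)`. -/
def rOrbit (F : Type*) [Field F] (ξ : Matrix (Fin 2) (Fin 2) F) :
    Set (Matrix (Fin 2) (Fin 2) F) :=
  {A | ∃ g, IsUnit g ∧ A = ξ * g}


section Blocks

variable {F : Type*} [Field F]

theorem Jmat_two : Jmat F 2 = !![0, 1; 1, 0] := by
  ext i j
  fin_cases i <;> fin_cases j <;> simp [Jmat]

theorem Jmat_two_mul_self : Jmat F 2 * Jmat F 2 = 1 := by
  rw [Jmat_two]
  ext i j
  fin_cases i <;> fin_cases j <;> simp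

theorem Jmat_two_mul_cancel_left (A : Matrix (Fin 2) (Fin 2) F) :
    Jmat F 2 * (Jmat F 2 * A) = A := by
  rw [← mul_assoc, Jmat_two_mul_self, one_mul]

theorem Jmat_two_transpose : (Jmat F 2)ᵀ = Jmat F 2 := by
  rw [Jmat_two]
  ext i j
  fin_cases i <;> fin_cases j <;> simp

theorem blk8_apply (B : Fin 4 → Fin 4 → Matrix (Fin 2) (Fin 2) F) (a b : Fin 4) (i j : Fin 2) :
    blk8 F B ⟨2 * (a : ℕ) + i, by omega⟩ ⟨2 * (b : ℕ) + j, by omega⟩ = B a b i j := by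
  have h (a : Fin 4) (i : Fin 2) : (2 * (a : ℕ) + i) / 2 = a := by omega
  have h' (a : Fin 4) (i : Fin 2) : (2 * (a : ℕ) + i) % 2 = i := by omega
  simp only [blk8, Matrix.of_apply, h, h', Fin.eta]

theorem eq_blk8_of_apply {g : Matrix (Fin 8) (Fin 8) F}
    {B : Fin 4 → Fin 4 → Matrix (Fin 2) (Fin 2) F}
    (h : ∀ (a b : Fin 4) (i j : Fin 2),
      g ⟨2 * (a : ℕ) + i, by omega⟩ ⟨2 * (b : ℕ) + j, by omega⟩ = B a b i j) :
    g = blk8 F B := by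
  ext i j
  simp only [blk8, Matrix.of_apply]
  rw [← h]
  simp only [Nat.div_add_mod]

theorem exists_eq_blk8 (g : Matrix (Fin 8) (Fin 8) F) : ∃ B, g = blk8 F B :=
  ⟨fun a b => Matrix.of fun i j => g ⟨2 * (a : ℕ) + i, by omega⟩ ⟨2 * (b : ℕ) + j, by omega⟩,
    eq_blk8_of_apply fun _ _ _ _ => rfl⟩

theorem blk8_injective : Function.Injective (blk8 F) := by
  intro B C h
  ext a b i j
  rw [← blk8_apply B, ← blk8_apply C, h]

theorem blk8_mul (B C : Fin 4 → Fin 4 → Matrix (Fin 2) (Fin 2) F) :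
    blk8 F B * blk8 F C = blk8 F fun i j => ∑ k, B i k * C k j := by
  ext i j
  simp only [blk8, Matrix.mul_apply, Matrix.of_apply, Matrix.sum_apply, Fin.sum_univ_eight,
    Fin.sum_univ_four, Fin.sum_univ_two]
  simp only [← add_assoc]
  rfl

theorem blk8_transpose (B : Fin 4 → Fin 4 → Matrix (Fin 2) (Fin 2) F) :
    (blk8 F B)ᵀ = blk8 F fun i j => (B j i)ᵀ := rfl

theorem OmegaMat_apply (n : ℕ) (i j : Fin (n + n)) : OmegaMat F n i j =
    if (i : ℕ) + j = n + n - 1 then if (i : ℕ) < n then 1 else -1 else 0 := by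
  obtain ⟨i, rfl⟩ := finSumFinEquiv.surjective i
  obtain ⟨j, rfl⟩ := finSumFinEquiv.surjective j
  rw [OmegaMat, Matrix.reindex_apply, Matrix.submatrix_apply, Equiv.symm_apply_apply,
    Equiv.symm_apply_apply]
  rcases i with i | i <;> rcases j with j | j <;>
    simp only [Jmat, Matrix.fromBlocks_apply₁₁, Matrix.fromBlocks_apply₁₂,
      Matrix.fromBlocks_apply₂₁, Matrix.fromBlocks_apply₂₂, Matrix.neg_apply, Matrix.of_apply,
      Matrix.zero_apply, finSumFinEquiv_apply_right, finSumFinEquiv_apply_left, Fin.val_natAdd,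
      Fin.val_castAdd] <;>
    split_ifs <;> first | omega | rfl | (simp; omega)

theorem OmegaMat_four : OmegaMat F 4 = blk8 F
    ![![0, 0, 0, Jmat F 2], ![0, 0, Jmat F 2, 0], ![0, -Jmat F 2, 0, 0],
      ![-Jmat F 2, 0, 0, 0]] := by
  refine eq_blk8_of_apply fun a b i j => (OmegaMat_apply 4 _ _).trans ?_
  fin_cases a <;> fin_cases b <;> fin_cases i <;> fin_cases j <;>
    first | rfl | exact neg_zero.symm

theorem blk8_mem_Sp8_iff (B : Fin 4 → Fin 4 → Matrix (Fin 2) (Fin 2) F) :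
    blk8 F B ∈ Sp8 F ↔ ∀ i j,
      (B 0 i)ᵀ * Jmat F 2 * B 3 j + (B 1 i)ᵀ * Jmat F 2 * B 2 j
        - (B 2 i)ᵀ * Jmat F 2 * B 1 j - (B 3 i)ᵀ * Jmat F 2 * B 0 j =
      (![![0, 0, 0, Jmat F 2], ![0, 0, Jmat F 2, 0], ![0, -Jmat F 2, 0, 0],
        ![-Jmat F 2, 0, 0, 0]] : Fin 4 → Fin 4 → Matrix (Fin 2) (Fin 2) F) i j := by
  have key : (blk8 F B)ᵀ * OmegaMat F 4 * blk8 F B = blk8 F fun i j =>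
      (B 0 i)ᵀ * Jmat F 2 * B 3 j + (B 1 i)ᵀ * Jmat F 2 * B 2 j
        - (B 2 i)ᵀ * Jmat F 2 * B 1 j - (B 3 i)ᵀ * Jmat F 2 * B 0 j := by
    rw [OmegaMat_four, blk8_transpose, blk8_mul, blk8_mul]
    congr 1
    funext i j
    simp [Fin.sum_univ_four]
    abel
  change (blk8 F B)ᵀ * OmegaMat F 4 * blk8 F B = OmegaMat F 4 ↔ _
  rw [key, OmegaMat_four, blk8_injective.eq_iff]
  simp only [funext_iff]

theorem OmegaMat_four_mul_self : OmegaMat F 4 * OmegaMat F 4 = -1 := by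
  rw [OmegaMat, Matrix.reindex_apply, Matrix.submatrix_mul_equiv, Matrix.fromBlocks_multiply]
  have hJ : Jmat F 4 * Jmat F 4 = 1 := by
    ext i j
    fin_cases i <;> fin_cases j <;> simp [Jmat, Matrix.mul_apply, Fin.sum_univ_four]
  have h1 : Matrix.fromBlocks (0 * 0 + Jmat F 4 * -Jmat F 4) (0 * Jmat F 4 + Jmat F 4 * 0)
      (-Jmat F 4 * 0 + 0 * -Jmat F 4) (-Jmat F 4 * Jmat F 4 + 0 * 0) = -1 := by
    simp [hJ, ← Matrix.fromBlocks_one, Matrix.fromBlocks_neg]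
  rw [h1, Matrix.submatrix_neg]
  exact congrArg Neg.neg (Matrix.submatrix_one_equiv _)

theorem isUnit_of_mem_Sp8 {g : Matrix (Fin 8) (Fin 8) F} (hg : g ∈ Sp8 F) : IsUnit g := by
  have hg' : gᵀ * OmegaMat F 4 * g = OmegaMat F 4 := hg
  refine IsUnit.of_mul_eq_one_right (-(OmegaMat F 4 * (gᵀ * OmegaMat F 4))) ?_
  rw [neg_mul, mul_assoc, hg']
  exact neg_eq_iff_eq_neg.mpr OmegaMat_four_mul_self

theorem Sp8_mul_mem {g h : Matrix (Fin 8) (Fin 8) F} (hg : g ∈ Sp8 F) (hh : h ∈ Sp8 F) :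
    g * h ∈ Sp8 F := by
  have hg' : gᵀ * OmegaMat F 4 * g = OmegaMat F 4 := hg
  have hh' : hᵀ * OmegaMat F 4 * h = OmegaMat F 4 := hh
  change (g * h)ᵀ * OmegaMat F 4 * (g * h) = OmegaMat F 4
  calc (g * h)ᵀ * OmegaMat F 4 * (g * h) = hᵀ * (gᵀ * OmegaMat F 4 * g) * h := by
        rw [Matrix.transpose_mul]; simp only [mul_assoc]
    _ = OmegaMat F 4 := by rw [hg', hh']

theorem mem_Sp8_of_mul_mem {g h : Matrix (Fin 8) (Fin 8) F} (hg : g ∈ Sp8 F)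
    (hgh : g * h ∈ Sp8 F) : h ∈ Sp8 F := by
  have hg' : gᵀ * OmegaMat F 4 * g = OmegaMat F 4 := hg
  have hgh' : (g * h)ᵀ * OmegaMat F 4 * (g * h) = OmegaMat F 4 := hgh
  change hᵀ * OmegaMat F 4 * h = OmegaMat F 4
  calc hᵀ * OmegaMat F 4 * h = hᵀ * (gᵀ * OmegaMat F 4 * g) * h := by rw [hg']
    _ = (g * h)ᵀ * OmegaMat F 4 * (g * h) := by
        rw [Matrix.transpose_mul]; simp only [mul_assoc]
    _ = OmegaMat F 4 := hgh'

/-- The `4 × 4` matrix with `2 × 2` blocks `a, b, c, d`. -/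
def blk4 {R : Type*} (a b c d : Matrix (Fin 2) (Fin 2) R) : Matrix (Fin 4) (Fin 4) R :=
  Matrix.reindex finSumFinEquiv finSumFinEquiv (Matrix.fromBlocks a b c d)

theorem exists_eq_blk4 {R : Type*} (h : Matrix (Fin 4) (Fin 4) R) : ∃ a b c d, h = blk4 a b c d := by
  let M : Matrix (Fin 2 ⊕ Fin 2) (Fin 2 ⊕ Fin 2) R :=
    Matrix.reindex finSumFinEquiv.symm finSumFinEquiv.symm h
  refine ⟨M.toBlocks₁₁, M.toBlocks₁₂, M.toBlocks₂₁, M.toBlocks₂₂, ?_⟩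
  rw [blk4, Matrix.fromBlocks_toBlocks]
  simp [M]

theorem blk4_inj {R : Type*} {a b c d a' b' c' d' : Matrix (Fin 2) (Fin 2) R} :
    blk4 a b c d = blk4 a' b' c' d' ↔ a = a' ∧ b = b' ∧ c = c' ∧ d = d' := by
  rw [blk4, blk4, Equiv.apply_eq_iff_eq, Matrix.fromBlocks_inj]

theorem blk4_mem_Sp4_iff (a b c d : Matrix (Fin 2) (Fin 2) F) :
    blk4 a b c d ∈ Sp4 F ↔
      aᵀ * Jmat F 2 * c - cᵀ * Jmat F 2 * a = 0 ∧
      aᵀ * Jmat F 2 * d - cᵀ * Jmat F 2 * b = Jmat F 2 ∧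
      bᵀ * Jmat F 2 * c - dᵀ * Jmat F 2 * a = -Jmat F 2 ∧
      bᵀ * Jmat F 2 * d - dᵀ * Jmat F 2 * b = 0 := by
  change (blk4 a b c d)ᵀ * OmegaMat F 2 * blk4 a b c d = OmegaMat F 2 ↔ _
  rw [blk4, OmegaMat, Matrix.transpose_reindex]
  simp only [Matrix.reindex_apply, Matrix.submatrix_mul_equiv, Matrix.fromBlocks_transpose,
    Matrix.fromBlocks_multiply]
  change blk4 _ _ _ _ = blk4 _ _ _ _ ↔ _
  rw [blk4_inj]
  simp [sub_eq_neg_add]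

theorem blk4_lower_left_eq_zero_iff (a b c d : Matrix (Fin 2) (Fin 2) F) :
    (∀ i j : Fin 4, 2 ≤ (i : ℕ) → (j : ℕ) < 2 → blk4 a b c d i j = 0) ↔ c = 0 := by
  constructor
  · intro h
    ext i j
    have := h (finSumFinEquiv (m := 2) (n := 2) (Sum.inr i))
      (finSumFinEquiv (m := 2) (n := 2) (Sum.inl j))
      (by rw [finSumFinEquiv_apply_right, Fin.val_natAdd]; omega)
      (by rw [finSumFinEquiv_apply_left, Fin.val_castAdd]; omega)
    simpa [blk4] using this
  · rintro rfl i j hi hj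
    fin_cases i <;> fin_cases j <;>
      first | rfl | exact absurd hi (by decide) | exact absurd hj (by decide)

theorem diag242_blk4 (m a b c d m' : Matrix (Fin 2) (Fin 2) F) :
    diag242 F m (blk4 a b c d) m' = blk8 F
      ![![m, 0, 0, 0], ![0, a, b, 0], ![0, c, d, 0], ![0, 0, 0, m']] := by
  refine eq_blk8_of_apply fun i j k l => ?_
  fin_cases i <;> fin_cases j <;> fin_cases k <;> fin_cases l <;> rfl

theorem vMat_eq_blk8 (x y z : Matrix (Fin 2) (Fin 2) F) :
    vMat F x y z = blk8 F
      ![![1, x, y, z], ![0, 1, 0, starJ F y], ![0, 0, 1, -starJ F x], ![0, 0, 0, 1]] := by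
  rw [vMat]
  congr 1
  funext i j
  fin_cases i <;> fin_cases j <;> rfl

theorem blk8_lower_left_eq_zero_iff (B : Fin 4 → Fin 4 → Matrix (Fin 2) (Fin 2) F) :
    (∀ i j : Fin 8, 4 ≤ (i : ℕ) → (j : ℕ) < 4 → blk8 F B i j = 0) ↔
      ∀ a b : Fin 4, 2 ≤ (a : ℕ) → (b : ℕ) < 2 → B a b = 0 := by
  constructor
  · intro h a b ha hb
    ext i j
    rw [← blk8_apply B]
    exact h _ _ (by simp; omega) (by simp; omega)
  · intro h i j hi hj
    simp only [blk8, Matrix.of_apply]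
    rw [h _ _ (by simp; omega) (by simp; omega)]
    rfl

theorem mem_E2_iff (v : Fin 8 → F) : v ∈ E2 F ↔ ∀ i : Fin 8, 2 ≤ (i : ℕ) → v i = 0 := by
  rw [E2, Submodule.mem_span_pair]
  constructor
  · rintro ⟨a, b, rfl⟩ i hi
    have h0 : i ≠ 0 := by rintro rfl; simp at hi
    have h1 : i ≠ 1 := by rintro rfl; simp at hi
    simp [h0, h1]
  · intro h
    refine ⟨v 0, v 1, ?_⟩
    funext i
    by_cases hi : 2 ≤ (i : ℕ)
    · have h0 : i ≠ 0 := by rintro rfl; simp at hi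
      have h1 : i ≠ 1 := by rintro rfl; simp at hi
      simp [h0, h1, h i hi]
    · have : i = 0 ∨ i = 1 := by
        simp only [Fin.ext_iff, Fin.val_zero, Fin.val_one]
        omega
      rcases this with rfl | rfl <;> simp

theorem map_E2_eq_iff {g : Matrix (Fin 8) (Fin 8) F} (hg : IsUnit g) :
    Submodule.map g.mulVecLin (E2 F) = E2 F ↔
      ∀ i j : Fin 8, 2 ≤ (i : ℕ) → (j : ℕ) < 2 → g i j = 0 := by
  constructor
  · intro h i j hi hj
    have hmem : g.mulVecLin (Pi.single j 1) ∈ E2 F := by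
      rw [← h]
      refine Submodule.mem_map_of_mem ((mem_E2_iff _).mpr fun k hk => ?_)
      have : k ≠ j := by rintro rfl; omega
      simp [this]
    simpa using (mem_E2_iff _).mp hmem i hi
  · intro h
    have hinj : Function.Injective g.mulVecLin := Matrix.mulVec_injective_of_isUnit hg
    refine Submodule.eq_of_le_of_finrank_eq ?_
      (LinearEquiv.finrank_eq (Submodule.equivMapOfInjective _ hinj (E2 F))).symm
    rintro _ ⟨v, hv, rfl⟩
    rw [mem_E2_iff]
    intro i hi
    rw [Matrix.mulVecLin_apply, Matrix.mulVec, dotProduct]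
    refine Finset.sum_eq_zero fun j _ => ?_
    by_cases hj : (j : ℕ) < 2
    · rw [h i j hi hj, zero_mul]
    · rw [(mem_E2_iff v).mp hv j (by omega), mul_zero]

theorem blk8_first_column_eq_zero_iff (B : Fin 4 → Fin 4 → Matrix (Fin 2) (Fin 2) F) :
    (∀ i j : Fin 8, 2 ≤ (i : ℕ) → (j : ℕ) < 2 → blk8 F B i j = 0) ↔
      ∀ a : Fin 4, a ≠ 0 → B a 0 = 0 := by
  constructor
  · intro h a ha
    have ha' : (a : ℕ) ≠ 0 := fun h0 => ha (Fin.ext h0)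
    ext i j
    rw [← blk8_apply B]
    exact h _ _ (by simp; omega) (by simp; omega)
  · intro h i j hi hj
    have hj' : (⟨(j : ℕ) / 2, by omega⟩ : Fin 4) = 0 := by
      ext
      simp
      omega
    simp only [blk8, Matrix.of_apply]
    rw [hj', h _ (by simp [Fin.ext_iff]; omega)]
    rfl

theorem mem_P8_inter_P28_iff (B : Fin 4 → Fin 4 → Matrix (Fin 2) (Fin 2) F) :
    blk8 F B ∈ P8 F ∩ P28 F ↔ blk8 F B ∈ Sp8 F ∧
      B 1 0 = 0 ∧ B 2 0 = 0 ∧ B 3 0 = 0 ∧ B 2 1 = 0 ∧ B 3 1 = 0 := by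
  constructor
  · rintro ⟨⟨hS, h1⟩, -, h2⟩
    rw [map_E2_eq_iff (isUnit_of_mem_Sp8 hS), blk8_first_column_eq_zero_iff] at h2
    rw [blk8_lower_left_eq_zero_iff] at h1
    exact ⟨hS, h2 1 (by decide), h2 2 (by decide), h2 3 (by decide),
      h1 2 1 (by simp) (by simp), h1 3 1 (by simp) (by simp)⟩
  · rintro ⟨hS, h10, h20, h30, h21, h31⟩
    refine ⟨⟨hS, ?_⟩, hS, ?_⟩
    · rw [blk8_lower_left_eq_zero_iff]
      intro a b ha hb
      fin_cases a <;> fin_cases b <;> simp_all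
    · rw [map_E2_eq_iff (isUnit_of_mem_Sp8 hS), blk8_first_column_eq_zero_iff]
      intro a ha
      fin_cases a <;> simp_all

theorem starJ_transpose_mul (y : Matrix (Fin 2) (Fin 2) F) :
    (starJ F y)ᵀ * Jmat F 2 = Jmat F 2 * y := by
  simp [starJ, Matrix.transpose_mul, Jmat_two_transpose, mul_assoc, Jmat_two_mul_self]

theorem Jmat_two_mul_starJ (y : Matrix (Fin 2) (Fin 2) F) :
    Jmat F 2 * starJ F y = yᵀ * Jmat F 2 := by
  simp [starJ, mul_assoc, Jmat_two_mul_cancel_left]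

theorem sub_mul_starJ_mem_Mat20_iff (x y z : Matrix (Fin 2) (Fin 2) F) :
    z - x * starJ F y ∈ Mat20 F ↔
      zᵀ * Jmat F 2 - (starJ F y)ᵀ * Jmat F 2 * starJ F x
        + (starJ F x)ᵀ * Jmat F 2 * starJ F y - Jmat F 2 * z = 0 := by
  change (z - x * starJ F y)ᵀ * Jmat F 2 = Jmat F 2 * (z - x * starJ F y) ↔ _
  rw [← sub_eq_zero, starJ_transpose_mul x, mul_assoc (starJ F y)ᵀ, Jmat_two_mul_starJ x]
  simp only [Matrix.transpose_sub, Matrix.transpose_mul, sub_mul, mul_sub, mul_assoc]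
  refine Eq.congr ?_ rfl
  abel

theorem vMat_mem_Sp8 {x y z : Matrix (Fin 2) (Fin 2) F} (h : z - x * starJ F y ∈ Mat20 F) :
    vMat F x y z ∈ Sp8 F := by
  rw [sub_mul_starJ_mem_Mat20_iff] at h
  rw [vMat_eq_blk8, blk8_mem_Sp8_iff]
  intro i j
  fin_cases i <;> fin_cases j <;>
    simp [Jmat_two_mul_starJ, starJ_transpose_mul]
  simpa [Jmat_two_mul_starJ, starJ_transpose_mul, sub_eq_add_neg] using h

/-- A symplectic matrix which is block unitriangular with trivial middle block lies in
`N_{2,8}`. -/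
theorem mem_N28_of_mem_Sp8 {x y z w u : Matrix (Fin 2) (Fin 2) F}
    (h : blk8 F ![![1, x, y, z], ![0, 1, 0, w], ![0, 0, 1, u], ![0, 0, 0, 1]] ∈ Sp8 F) :
    blk8 F ![![1, x, y, z], ![0, 1, 0, w], ![0, 0, 1, u], ![0, 0, 0, 1]] ∈ N28 F := by
  rw [blk8_mem_Sp8_iff] at h
  have h13 := h 1 3
  have h23 := h 2 3
  have h33 := h 3 3
  simp at h13 h23 h33
  have hu : u = -starJ F x := by
    rw [← Jmat_two_mul_cancel_left u, eq_neg_of_add_eq_zero_right h13, starJ, mul_neg, mul_assoc]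
  have hw : w = starJ F y := by
    rw [← Jmat_two_mul_cancel_left w, ← sub_eq_zero.mp h23, starJ, mul_assoc]
  subst hu hw
  refine ⟨x, y, z, ?_, (vMat_eq_blk8 x y z).symm⟩
  rw [sub_mul_starJ_mem_Mat20_iff]
  simpa [sub_eq_add_neg] using h33

theorem diag242_mem_Sp8 {g₀ a b d : Matrix (Fin 2) (Fin 2) F} (hg : IsUnit g₀)
    (h : blk4 a b 0 d ∈ Sp4 F) :
    diag242 F g₀ (blk4 a b 0 d) (Jmat F 2 * (g₀⁻¹)ᵀ * Jmat F 2) ∈ Sp8 F := by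
  have hdet := (Matrix.isUnit_iff_isUnit_det g₀).mp hg
  rw [blk4_mem_Sp4_iff] at h
  simp at h
  obtain ⟨h1, h2, h3⟩ := h
  have e1 : g₀ᵀ * (g₀⁻¹)ᵀ = 1 := by
    rw [← Matrix.transpose_mul, Matrix.nonsing_inv_mul _ hdet, Matrix.transpose_one]
  rw [diag242_blk4, blk8_mem_Sp8_iff]
  intro i j
  fin_cases i <;> fin_cases j <;>
    simp [h1, h2, h3, Jmat_two_transpose, Matrix.transpose_mul]
  · rw [mul_assoc, mul_assoc (Jmat F 2), Jmat_two_mul_cancel_left, ← mul_assoc, e1, one_mul]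
  · rw [mul_assoc (Jmat F 2), mul_assoc (g₀⁻¹), Jmat_two_mul_self, mul_one, mul_assoc,
      Matrix.nonsing_inv_mul _ hdet, mul_one]

theorem isUnit_of_transpose_mul_Jmat_two_mul {a d : Matrix (Fin 2) (Fin 2) F}
    (h : aᵀ * Jmat F 2 * d = Jmat F 2) : IsUnit a := by
  rw [← Matrix.isUnit_transpose]
  refine IsUnit.of_mul_eq_one (Jmat F 2 * d * Jmat F 2) ?_
  rw [← mul_assoc, ← mul_assoc, h, Jmat_two_mul_self]

theorem isUnit_of_transpose_mul_Jmat_two_mul' {a d : Matrix (Fin 2) (Fin 2) F}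
    (h : aᵀ * Jmat F 2 * d = Jmat F 2) : IsUnit d := by
  refine IsUnit.of_mul_eq_one_right (Jmat F 2 * (aᵀ * Jmat F 2)) ?_
  rw [mul_assoc, h, Jmat_two_mul_self]

/-- The Levi part of an element of `Sp_8` whose block matrix is upper triangular: the first
diagonal block is invertible, it determines the last one, and the middle part lies in `P_4`. -/
theorem levi_part_of_mem_Sp8 {B : Fin 4 → Fin 4 → Matrix (Fin 2) (Fin 2) F}
    (hS : blk8 F B ∈ Sp8 F) (h10 : B 1 0 = 0) (h20 : B 2 0 = 0) (h30 : B 3 0 = 0)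
    (h21 : B 2 1 = 0) (h31 : B 3 1 = 0) :
    IsUnit (B 0 0) ∧ B 3 2 = 0 ∧ B 3 3 = Jmat F 2 * ((B 0 0)⁻¹)ᵀ * Jmat F 2 ∧
      blk4 (B 1 1) (B 1 2) 0 (B 2 2) ∈ Sp4 F := by
  rw [blk8_mem_Sp8_iff] at hS
  have h02 := hS 0 2
  have h03 := hS 0 3
  have h12 := hS 1 2
  have h21' := hS 2 1
  have h22 := hS 2 2
  simp [h10, h20, h30, h21, h31] at h02 h03 h12 h21' h22
  have hunit := isUnit_of_transpose_mul_Jmat_two_mul h03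
  have hinv : ((B 0 0)⁻¹)ᵀ * (B 0 0)ᵀ = 1 := by
    rw [← Matrix.transpose_mul, Matrix.mul_nonsing_inv _ ((Matrix.isUnit_iff_isUnit_det _).mp hunit),
      Matrix.transpose_one]
  have hcancel (A : Matrix (Fin 2) (Fin 2) F) :
      Jmat F 2 * ((B 0 0)⁻¹)ᵀ * ((B 0 0)ᵀ * Jmat F 2 * A) = A := by
    rw [mul_assoc, ← mul_assoc ((B 0 0)⁻¹)ᵀ, ← mul_assoc ((B 0 0)⁻¹)ᵀ, hinv, one_mul,
      Jmat_two_mul_cancel_left]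
  have h32 : B 3 2 = 0 := by rw [← hcancel (B 3 2), h02, mul_zero]
  refine ⟨hunit, h32, by rw [← hcancel (B 3 3), h03], ?_⟩
  simp [h32] at h12 h21' h22
  rw [blk4_mem_Sp4_iff]
  simp [h12, h21', h22]

end Blocks

/-- `P_8(F) ∩ P_{2,8}(F)
  = { diag(g₀, h₀, J₂ ᵗg₀⁻¹ J₂) · v : g₀ ∈ GL_2(F), h₀ ∈ P_4(F), v ∈ N_{2,8}(F) }`. -/
theorem statement14 (F : Type*) [Field F] :
    P8 F ∩ P28 F =
      {g | ∃ (g₀ : Matrix (Fin 2) (Fin 2) F) (h₀ : Matrix (Fin 4) (Fin 4) F)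
            (v : Matrix (Fin 8) (Fin 8) F),
          IsUnit g₀ ∧ h₀ ∈ P4 F ∧ v ∈ N28 F ∧
          g = diag242 F g₀ h₀ (Jmat F 2 * (g₀⁻¹)ᵀ * Jmat F 2) * v} := by
  ext g
  constructor
  · intro hg
    obtain ⟨B, rfl⟩ := exists_eq_blk8 g
    obtain ⟨hS, h10, h20, h30, h21, h31⟩ := (mem_P8_inter_P28_iff B).mp hg
    obtain ⟨hunit, h32, h33, hmid⟩ := levi_part_of_mem_Sp8 hS h10 h20 h30 h21 h31
    have hD := diag242_mem_Sp8 hunit hmid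
    have had : (B 1 1)ᵀ * Jmat F 2 * B 2 2 = Jmat F 2 := by
      simpa using ((blk4_mem_Sp4_iff _ _ _ _).mp hmid).2.1
    have hg (A : Matrix (Fin 2) (Fin 2) F) :=
      Matrix.mul_nonsing_inv_cancel_left _ A ((Matrix.isUnit_iff_isUnit_det _).mp hunit)
    have ha (A : Matrix (Fin 2) (Fin 2) F) := Matrix.mul_nonsing_inv_cancel_left _ A
      ((Matrix.isUnit_iff_isUnit_det _).mp (isUnit_of_transpose_mul_Jmat_two_mul had))
    have hd (A : Matrix (Fin 2) (Fin 2) F) := Matrix.mul_nonsing_inv_cancel_left _ A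
      ((Matrix.isUnit_iff_isUnit_det _).mp (isUnit_of_transpose_mul_Jmat_two_mul' had))
    have hfac : blk8 F B = diag242 F (B 0 0) (blk4 (B 1 1) (B 1 2) 0 (B 2 2))
        (Jmat F 2 * ((B 0 0)⁻¹)ᵀ * Jmat F 2) * blk8 F
          ![![1, (B 0 0)⁻¹ * B 0 1, (B 0 0)⁻¹ * B 0 2, (B 0 0)⁻¹ * B 0 3],
            ![0, 1, 0, (B 1 1)⁻¹ * (B 1 3 - B 1 2 * ((B 2 2)⁻¹ * B 2 3))],
            ![0, 0, 1, (B 2 2)⁻¹ * B 2 3], ![0, 0, 0, 1]] := by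
      rw [← h33, diag242_blk4, blk8_mul]
      congr 1
      funext i j
      fin_cases i <;> fin_cases j <;>
        simp [Fin.sum_univ_four, h10, h20, h30, h21, h31, h32, hg, ha, hd]
    exact ⟨_, _, _, hunit, ⟨hmid, (blk4_lower_left_eq_zero_iff _ _ _ _).mpr rfl⟩,
      mem_N28_of_mem_Sp8 (mem_Sp8_of_mul_mem hD (hfac ▸ hS)), hfac⟩
  · rintro ⟨g₀, h₀, v, hg₀, ⟨hS, hl⟩, ⟨x, y, z, hz, rfl⟩, rfl⟩
    obtain ⟨a, b, c, d, rfl⟩ := exists_eq_blk4 h₀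
    obtain rfl := (blk4_lower_left_eq_zero_iff a b c d).mp hl
    have hmem := Sp8_mul_mem (diag242_mem_Sp8 hg₀ hS) (vMat_mem_Sp8 hz)
    rw [diag242_blk4, vMat_eq_blk8, blk8_mul] at hmem ⊢
    refine (mem_P8_inter_P28_iff _).mpr ⟨hmem, ?_⟩
    simp [Fin.sum_univ_four]

end

end GS
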